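/- arXiv:1911.01555 — 2 statements merged into one kernel-verified Lean document; each statement's English description precedes it below -/
import Mathlib

section
/- Let G be an edge-colored graph on n vertices containing no properly colored K_{2,2}. Then G contains a spanning subgraph H admitting an orientation D such that every vertex v satisfies d⁺_D(v) > d^c_G(v) − 2√n − 2, and every directed cycle of D is a properly colored cycle in H. -/
open Classical in
theorem aux_X {n : ℕ} (N : Fin n → Finset (Fin n))
    (hN : ∀ x y, x ≠ y → (N x ∩ N y).card ≤ 1) :
    ∃ X : Finset (Fin n), (X.card : ℝ) ≤ Real.sqrt n + 1 ∧
      ∀ v, v ∉ X → ((N v).card : ℝ) + X.card < 2 * Real.sqrt n + 2 := by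
  by_contra hcon
  push Not at hcon
  have hs0 : 0 ≤ Real.sqrt n := Real.sqrt_nonneg _
  have hsq : Real.sqrt n * Real.sqrt n = n := Real.mul_self_sqrt (Nat.cast_nonneg n)
  have hm1 : ((⌊Real.sqrt n⌋₊ : ℕ) : ℝ) ≤ Real.sqrt n := Nat.floor_le hs0
  have hm2 : Real.sqrt n < (⌊Real.sqrt n⌋₊ : ℕ) + 1 := Nat.lt_floor_add_one _
  have key : ∀ k : ℕ, k ≤ ⌊Real.sqrt n⌋₊ + 1 → ∃ X : Finset (Fin n), X.card = k ∧
      (k : ℝ) * (2 * Real.sqrt n + 3 - k) ≤ ((X.biUnion N).card : ℝ) := by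
    intro k
    induction k with
    | zero => intro _; exact ⟨∅, by simp, by simp⟩
    | succ k ih =>
      intro hk
      obtain ⟨X, hX, hU⟩ := ih (by omega)
      have hk' : (k : ℝ) ≤ (⌊Real.sqrt n⌋₊ : ℕ) := by exact_mod_cast (by omega)
      obtain ⟨v, hv, hlt⟩ := hcon X (by rw [hX]; linarith)
      refine ⟨insert v X, by rw [Finset.card_insert_of_notMem hv, hX], ?_⟩
      rw [Finset.biUnion_insert]
      have h1 := Finset.card_union_add_card_inter (N v) (X.biUnion N)
      have h2 : (N v ∩ X.biUnion N).card ≤ k := by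
        rw [Finset.inter_biUnion]
        refine Finset.card_biUnion_le.trans ?_
        calc ∑ x ∈ X, (N v ∩ N x).card ≤ ∑ x ∈ X, 1 := by
              apply Finset.sum_le_sum
              intro x hx
              exact hN v x (by rintro rfl; exact hv hx)
          _ = k := by simp [hX]
      have h1' : ((N v ∪ X.biUnion N).card : ℝ) + (N v ∩ X.biUnion N).card
        = (N v).card + (X.biUnion N).card := by exact_mod_cast h1
      have h2' : ((N v ∩ X.biUnion N).card : ℝ) ≤ k := by exact_mod_cast h2
      rw [hX] at hlt
      push_cast
      nlinarith
  obtain ⟨X, -, hU⟩ := key _ le_rfl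
  have h3 : ((X.biUnion N).card : ℝ) ≤ n := by
    have := Finset.card_le_univ (X.biUnion N)
    rw [Fintype.card_fin] at this
    exact_mod_cast this
  push_cast at hU
  nlinarith

theorem aux_min {n : ℕ} {C : Type*} (G : SimpleGraph (Fin n)) (c : Fin n → Fin n → C)
    (hc : ∀ u v, c u v = c v u) :
    ∃ H : SimpleGraph (Fin n), H ≤ G ∧
      (∀ v, c v '' {u | H.Adj v u} = c v '' {u | G.Adj v u}) ∧
      ∀ u v, H.Adj u v → (∀ z, H.Adj u z → c u z = c u v → z = v) ∨
        (∀ z, H.Adj v z → c v z = c v u → z = u) := by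
  obtain ⟨H, hH⟩ := exists_minimal_of_wellFoundedLT
    (fun H : SimpleGraph (Fin n) => H ≤ G ∧
      ∀ v, c v '' {u | H.Adj v u} = c v '' {u | G.Adj v u}) ⟨G, le_rfl, fun _ => rfl⟩
  refine ⟨H, hH.prop.1, hH.prop.2, ?_⟩
  intro u v huv
  by_contra hcon
  push Not at hcon
  obtain ⟨⟨z, hz, hzc, hzv⟩, ⟨z', hz', hzc', hzu'⟩⟩ := hcon
  have hle : H.deleteEdges {s(u, v)} ≤ H := SimpleGraph.deleteEdges_le _
  have hQ := hH.2 (y := H.deleteEdges {s(u, v)}) ⟨hle.trans hH.prop.1, by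
    intro w
    rw [← hH.prop.2 w]
    apply Set.Subset.antisymm
    · exact Set.image_mono fun x hx => hle hx
    · rintro _ ⟨x, hx, rfl⟩
      have hx : H.Adj w x := hx
      by_cases h : s(w, x) = s(u, v)
      · rw [Sym2.eq_iff] at h
        rcases h with ⟨rfl, rfl⟩ | ⟨rfl, rfl⟩
        · refine ⟨z, ?_, hzc⟩
          simp only [Set.mem_ofPred_eq, SimpleGraph.deleteEdges_adj, Set.mem_singleton_iff,
            Sym2.eq_iff]
          exact ⟨hz, by rintro (⟨-, h⟩ | ⟨h, -⟩); exacts [hzv h, huv.ne h]⟩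
        · refine ⟨z', ?_, hzc'⟩
          simp only [Set.mem_ofPred_eq, SimpleGraph.deleteEdges_adj, Set.mem_singleton_iff,
            Sym2.eq_iff]
          exact ⟨hz', by rintro (⟨h, -⟩ | ⟨-, h⟩); exacts [huv.ne h.symm, hzu' h]⟩
      · refine ⟨x, ?_, rfl⟩
        simp only [Set.mem_ofPred_eq, SimpleGraph.deleteEdges_adj, Set.mem_singleton_iff]
        exact ⟨hx, h⟩⟩ hle
  have := hQ huv
  simp [SimpleGraph.deleteEdges_adj] at this

/-- Each edge of `H` points from the leaf to the centre of its monochromatic star. -/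
theorem aux_star {n : ℕ} {C : Type*} (H : SimpleGraph (Fin n)) (c : Fin n → Fin n → C)
    (hc : ∀ u v, c u v = c v u)
    (hmin : ∀ u v, H.Adj u v → (∀ z, H.Adj u z → c u z = c u v → z = v) ∨
        (∀ z, H.Adj v z → c v z = c v u → z = u)) :
    ∃ P : Fin n → Fin n → Prop,
      (∀ u v, H.Adj u v ↔ (P u v ∨ P v u)) ∧
      (∀ y x x', P y x → P y x' → c y x = c y x' → x = x') ∧
      (∀ y x z, P y x → P x z → c x y = c x z → False) := by
  refine ⟨fun y x => H.Adj y x ∧ (∀ z, H.Adj y z → c y z = c y x → z = x) ∧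
    (¬ (∀ z, H.Adj x z → c x z = c x y → z = y) ∨ y < x), ?_, ?_, ?_⟩
  · intro u v
    constructor
    · intro h
      have h1 := hmin u v h
      have h2 := h.symm
      have h3 := lt_or_gt_of_ne h.ne
      tauto
    · rintro (h | h)
      · exact h.1
      · exact h.1.symm
  · rintro y x x' ⟨h1, h2, h3⟩ ⟨h1', h2', h3'⟩ he
    exact h2' x h1 he
  · rintro y x z ⟨h1, h2, h3⟩ ⟨h1', h2', h3'⟩ he
    have hyz := h2' y h1.symm he
    subst hyz
    rcases h3 with h3 | h3
    · exact h3 h2'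
    · rcases h3' with h3' | h3'
      · exact h3' h2
      · exact lt_asymm h3 h3'

theorem stmt_10 {n : ℕ} {C : Type*} (G : SimpleGraph (Fin n)) (c : Fin n → Fin n → C)
    (hc : ∀ u v, c u v = c v u)
    (hno : ¬ ∃ a a' b b' : Fin n, a ≠ a' ∧ b ≠ b' ∧ a ≠ b ∧ a ≠ b' ∧ a' ≠ b ∧ a' ≠ b' ∧
      G.Adj a b ∧ G.Adj a b' ∧ G.Adj a' b ∧ G.Adj a' b' ∧
      c a b ≠ c a b' ∧ c a' b ≠ c a' b' ∧ c a b ≠ c a' b ∧ c a b' ≠ c a' b') :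
    ∃ (H : SimpleGraph (Fin n)) (D : Fin n → Fin n → Prop),
      H ≤ G ∧
      (∀ u v, D u v → ¬ D v u) ∧
      (∀ u v, H.Adj u v ↔ (D u v ∨ D v u)) ∧
      (∀ v : Fin n, (((c v) '' {u | G.Adj v u}).ncard : ℝ) - 2 * Real.sqrt n - 2 <
        ({u | D v u}.ncard : ℝ)) ∧
      (∀ m : ℕ, 3 ≤ m → ∀ f : ZMod m → Fin n, Function.Injective f →
        (∀ i, D (f i) (f (i + 1))) →
        ∀ i, c (f i) (f (i + 1)) ≠ c (f (i + 1)) (f (i + 2))) := by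
  classical
  obtain ⟨H, hHG, hcol, hmin⟩ := aux_min G c hc
  obtain ⟨P, hP, huniq, hnot⟩ := aux_star H c hc hmin
  have hN : ∀ x, ∃ N : Finset (Fin n), (∀ y ∈ N, P y x) ∧ Set.InjOn (c x) N ∧
      c x '' N = c x '' {y | P y x} := by
    intro x
    obtain ⟨s', hs', hb⟩ := Set.exists_subset_bijOn {y | P y x} (c x)
    refine ⟨s'.toFinset, ?_, ?_, ?_⟩
    · intro y hy
      exact hs' (by simpa using hy)
    · simpa using hb.injOn
    · simpa using hb.image_eq
  choose N hNP hNinj hNim using hN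
  obtain ⟨X, hX1, hX2⟩ := aux_X N (by
    intro x x' hxx
    by_contra hlt
    push Not at hlt
    obtain ⟨y, hy, y', hy', hne⟩ := Finset.one_lt_card.1 hlt
    rw [Finset.mem_inter] at hy hy'
    have p1 := hNP _ _ hy.1
    have p2 := hNP _ _ hy.2
    have p3 := hNP _ _ hy'.1
    have p4 := hNP _ _ hy'.2
    have a1 := (hP x y).2 (Or.inr p1)
    have a2 := (hP x' y).2 (Or.inr p2)
    have a3 := (hP x y').2 (Or.inr p3)
    have a4 := (hP x' y').2 (Or.inr p4)
    refine hno ⟨x, x', y, y', hxx, hne, a1.ne, a3.ne, a2.ne, a4.ne, hHG a1, hHG a3, hHG a2,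
      hHG a4, ?_, ?_, ?_, ?_⟩
    · intro h; exact hne (hNinj x hy.1 hy'.1 h)
    · intro h; exact hne (hNinj x' hy.2 hy'.2 h)
    · intro h; exact hxx (huniq y x x' p1 p2 (by rw [hc y x, hc y x', h]))
    · intro h; exact hxx (huniq y' x x' p3 p4 (by rw [hc y' x, hc y' x', h])))
  let Out : Fin n → C → Prop := fun x α => x ∈ X ∧ ∀ y, P y x → c x y = α → y ∉ X
  let D : Fin n → Fin n → Prop := fun u v =>
    (P u v ∧ ¬ Out v (c u v)) ∨ (P v u ∧ Out u (c u v))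
  have hD : ∀ u v w, D u v → D v w → c u v ≠ c v w := by
    rintro u v w (⟨h1, h2⟩ | ⟨h1, h2⟩) (⟨h3, h4⟩ | ⟨h3, h4⟩) he
    · exact hnot u v w h1 h3 (by rw [hc v u, he])
    · exact h2 (he ▸ h4)
    · have := huniq v u w h1 h3 (by rw [hc v u, he])
      subst this
      exact h4 (he ▸ h2)
    · exact hnot w v u h3 h1 (by rw [hc v u, he])
  refine ⟨H, D, hHG, ?_, ?_, ?_, ?_⟩
  · intro u v h1 h2
    exact hD u v u h1 h2 (hc u v)
  · intro u v
    rw [hP]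
    simp only [D]
    rw [hc v u]
    tauto
  · intro v
    rw [← hcol v]
    -- the lost colours
    have hcover : ∃ L : Set C, (L.ncard : ℝ) < 2 * Real.sqrt n + 2 ∧ L.Finite ∧
        c v '' {u | H.Adj v u} ⊆ L ∪ c v '' {u | D v u} := by
      have hXim : (c v '' (X : Set (Fin n))).ncard ≤ X.card := by
        have := Set.ncard_image_le (f := c v) X.finite_toSet
        rwa [Set.ncard_coe_finset] at this
      have hXim' : ((c v '' (X : Set (Fin n))).ncard : ℝ) ≤ X.card := by exact_mod_cast hXim
      by_cases hv : v ∈ X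
      · refine ⟨c v '' X, ?_, Set.toFinite _, ?_⟩
        · have := Real.sqrt_nonneg (n : ℝ)
          linarith
        · rintro _ ⟨w, hw, rfl⟩
          rcases (hP v w).1 hw with h | h
          · right
            exact ⟨w, Or.inl ⟨h, fun ho => ho.2 v h (hc w v) hv⟩, rfl⟩
          · by_cases ho : Out v (c v w)
            · right
              exact ⟨w, Or.inr ⟨h, ho⟩, rfl⟩
            · left
              simp only [Out, not_and, not_forall, not_not] at ho
              obtain ⟨y, hy, hyc, hyX⟩ := ho hv
              exact ⟨y, hyX, hyc⟩
      · refine ⟨c v '' X ∪ c v '' N v, ?_, Set.toFinite _, ?_⟩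
        · have h1 := Set.ncard_union_le (c v '' (X : Set (Fin n))) (c v '' (N v : Set (Fin n)))
          have h2 := Set.ncard_image_le (f := c v) (N v).finite_toSet
          rw [Set.ncard_coe_finset] at h2
          have h3 : ((c v '' (X : Set (Fin n)) ∪ c v '' (N v : Set (Fin n))).ncard : ℝ)
              ≤ X.card + (N v).card := by
            rw [← Nat.cast_add]
            exact Nat.cast_le.2 (by omega)
          have := hX2 v hv
          linarith
        · rintro _ ⟨w, hw, rfl⟩
          rcases (hP v w).1 hw with h | h
          · by_cases ho : Out w (c v w)
            · left; left
              exact ⟨w, ho.1, rfl⟩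
            · right
              exact ⟨w, Or.inl ⟨h, ho⟩, rfl⟩
          · left; right
            rw [hNim v]
            exact ⟨w, h, rfl⟩
    obtain ⟨L, hL, hLf, hsub⟩ := hcover
    have h1 := Set.ncard_le_ncard hsub (hLf.union (Set.toFinite _))
    have h2 := Set.ncard_union_le L (c v '' {u | D v u})
    have h3 := Set.ncard_image_le (f := c v) (Set.toFinite {u | D v u})
    have h4 : ((c v '' {u | H.Adj v u}).ncard : ℝ) ≤ L.ncard + {u | D v u}.ncard := by
      exact_mod_cast (by omega)
    linarith
  · intro m _ f _ hf i
    have h := hf (i + 1)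
    have e : i + 1 + 1 = i + 2 := by ring
    rw [e] at h
    exact hD _ _ _ (hf i) h
end

section
/- Let G be an edge-colored graph on n vertices with no properly colored cycle of length 4 and with minimum color degree δ^c(G) ≥ d. Suppose every digraph on n vertices with minimum out-degree at least f contains a directed cycle of length at most 4, and d > f + 2√2·√n + 1. Then G contains a properly colored cycle of length at most 4; hence G contains a properly colored cycle of length exactly 3 (a rainbow triangle), a contradiction structure showing: every edge-colored graph on n vertices with δ^c(G) ≥ f(n,4) + 2√2·√n + 2 contains a properly colored cycle of length at most 4. -/
open Finset in
open Classical in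
theorem aux_exQ {V C : Type*} (L : V → V → Prop) (c : V → V → C) (k : ℕ)
    (stuck : ∀ B Y : Finset V, B.Nonempty ∨ Y.Nonempty →
      (∃ x ∈ B, ((Y.filter (fun y => L y x)).image (c x)).card ≤ k) ∨
      (∃ y ∈ Y, (B.filter (fun x => L y x)).card ≤ k)) :
    ∀ (N : ℕ) (B Y : Finset V), B.card + Y.card = N → ∃ Q : V → C → Prop,
      (∀ x ∈ B, (((Y.filter (fun y => L y x)).image (c x)).filter (fun i => ¬ Q x i)).card ≤ k) ∧
      (∀ y ∈ Y, (B.filter (fun x => L y x ∧ Q x (c x y))).card ≤ k) := by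
  intro N
  induction N with
  | zero =>
    intro B Y h
    have hB : B = ∅ := by rw [← Finset.card_eq_zero]; omega
    have hY : Y = ∅ := by rw [← Finset.card_eq_zero]; omega
    subst hB hY
    exact ⟨fun _ _ => True, by simp, by simp⟩
  | succ N ih =>
    intro B Y h
    have hne : B.Nonempty ∨ Y.Nonempty := by
      by_contra hcon
      push Not at hcon
      rw [hcon.1, hcon.2] at h
      simp at h
    rcases stuck B Y hne with ⟨x, hx, hxk⟩ | ⟨y, hy, hyk⟩
    · obtain ⟨Q, h1, h2⟩ := ih (B.erase x) Y (by
        rw [Finset.card_erase_of_mem hx]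
        have := Finset.card_pos.2 ⟨x, hx⟩
        omega)
      refine ⟨fun z i => z ≠ x ∧ Q z i, ?_, ?_⟩
      · intro z hz
        by_cases hzx : z = x
        · subst hzx
          refine le_trans (Finset.card_le_card ?_) hxk
          intro i hi
          simp only [Finset.mem_filter] at hi
          exact hi.1
        · have := h1 z (Finset.mem_erase.2 ⟨hzx, hz⟩)
          simpa [hzx] using this
      · intro y hy
        refine le_trans (Finset.card_le_card ?_) (h2 y hy)
        intro z hz
        simp only [Finset.mem_filter, Finset.mem_erase] at hz ⊢
        tauto
    · obtain ⟨Q, h1, h2⟩ := ih B (Y.erase y) (by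
        rw [Finset.card_erase_of_mem hy]
        have := Finset.card_pos.2 ⟨y, hy⟩
        omega)
      refine ⟨fun z i => (∃ w ∈ Y.erase y, L w z ∧ c z w = i) → Q z i, ?_, ?_⟩
      · intro x hx
        refine le_trans (Finset.card_le_card ?_) (h1 x hx)
        intro i hi
        simp only [Finset.mem_filter, Finset.mem_image, Classical.not_imp] at hi ⊢
        obtain ⟨-, ⟨w, hw, hwx, hwi⟩, hq⟩ := hi
        exact ⟨⟨w, ⟨hw, hwx⟩, hwi⟩, hq⟩
      · intro w hw
        by_cases hwy : w = y
        · subst hwy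
          refine le_trans (Finset.card_le_card ?_) hyk
          intro z hz
          simp only [Finset.mem_filter] at hz ⊢
          tauto
        · refine le_trans (Finset.card_le_card ?_) (h2 w (Finset.mem_erase.2 ⟨hwy, hw⟩))
          intro z hz
          simp only [Finset.mem_filter] at hz ⊢
          exact ⟨hz.1, hz.2.1, hz.2.2 ⟨w, Finset.mem_erase.2 ⟨hwy, hw⟩, hz.2.1, rfl⟩⟩

open Finset in
open Classical in
theorem aux_count {V : Type*} (R : V → V → Prop) (B Y : Finset V)
    (hR : ∀ x ∈ B, ∀ x' ∈ B, ∀ y ∈ Y, ∀ y' ∈ Y, x ≠ x' → R x y → R x' y → R x y' → R x' y' →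
      y = y') (e : ℕ) (he : e = ∑ x ∈ B, (Y.filter (fun y => R x y)).card) :
    e ^ 2 ≤ Y.card * (B.card ^ 2 + e) := by
  have h1 : e = ∑ y ∈ Y, (B.filter (fun x => R x y)).card := by
    rw [he]; exact Finset.sum_card_bipartiteAbove_eq_sum_card_bipartiteBelow R
  have h2 : e ^ 2 ≤ Y.card * ∑ y ∈ Y, (B.filter (fun x => R x y)).card ^ 2 := by
    conv_lhs => rw [h1]
    exact sq_sum_le_card_mul_sum_sq
  have h3 : ∑ y ∈ Y, (B.filter (fun x => R x y)).card ^ 2 =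
      ∑ p ∈ B ×ˢ B, (Y.filter (fun y => R p.1 y ∧ R p.2 y)).card := by
    have := Finset.sum_card_bipartiteAbove_eq_sum_card_bipartiteBelow
      (s := B ×ˢ B) (t := Y) (fun (p : V × V) y => R p.1 y ∧ R p.2 y)
    unfold Finset.bipartiteAbove Finset.bipartiteBelow at this
    rw [this]
    refine Finset.sum_congr rfl fun y _ => ?_
    rw [Finset.filter_product (fun x => R x y) (fun x => R x y), Finset.card_product, sq]
  have h4 : ∑ p ∈ B ×ˢ B, (Y.filter (fun y => R p.1 y ∧ R p.2 y)).card ≤ B.card ^ 2 + e := by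
    calc ∑ p ∈ B ×ˢ B, (Y.filter (fun y => R p.1 y ∧ R p.2 y)).card
        ≤ ∑ p ∈ B ×ˢ B, (1 + if p.1 = p.2 then (Y.filter (fun y => R p.1 y)).card else 0) := by
          refine Finset.sum_le_sum fun p hp => ?_
          rw [Finset.mem_product] at hp
          by_cases hpp : p.1 = p.2
          · simp [← hpp]
          · simp only [hpp, if_false, add_zero]
            rw [Finset.card_le_one]
            intro a ha b hb
            rw [Finset.mem_filter] at ha hb
            exact hR p.1 hp.1 p.2 hp.2 a ha.1 b hb.1 hpp ha.2.1 ha.2.2 hb.2.1 hb.2.2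
      _ = B.card ^ 2 + e := by
          rw [Finset.sum_add_distrib, Finset.sum_product, Finset.sum_product]
          congr 1
          · simp [sq]
          · rw [he]
            refine Finset.sum_congr rfl fun x hx => ?_
            simp [hx]
  rw [h3] at h2
  exact h2.trans (Nat.mul_le_mul_left _ h4)

open Finset in
open Classical in
theorem aux_stuck {n : ℕ} {C : Type*} (L : Fin n → Fin n → Prop) (c : Fin n → Fin n → C) (k : ℕ)
    (hk : 2 * n < (k + 1) ^ 2)
    (hC4 : ∀ x x' y y', x ≠ x' → y ≠ y' → L y x → L y x' → L y' x → L y' x' →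
      c x y ≠ c x y' → c x' y ≠ c x' y' → False) (B Y : Finset (Fin n))
    (hne : B.Nonempty ∨ Y.Nonempty) :
      (∃ x ∈ B, ((Y.filter (fun y => L y x)).image (c x)).card ≤ k) ∨
      (∃ y ∈ Y, (B.filter (fun x => L y x)).card ≤ k) := by
  by_contra hcon
  push Not at hcon
  obtain ⟨hB, hY⟩ := hcon
  have hpick : ∀ x i, ∃ y, (∃ w, w ∈ Y ∧ L w x ∧ c x w = i) → y ∈ Y ∧ L y x ∧ c x y = i := by
    intro x i
    by_cases h : ∃ w, w ∈ Y ∧ L w x ∧ c x w = i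
    · obtain ⟨w, hw⟩ := h
      exact ⟨w, fun _ => hw⟩
    · exact ⟨x, fun h' => absurd h' h⟩
  choose pick hpick using hpick
  let R : Fin n → Fin n → Prop := fun x y => L y x ∧ y = pick x (c x y)
  have hdeg : ∀ x ∈ B, k + 1 ≤ (Y.filter (fun y => R x y)).card := by
    intro x hx
    refine le_trans (hB x hx) ?_
    refine le_trans (Finset.card_le_card ?_)
      (Finset.card_image_le (s := Y.filter (fun y => R x y)) (f := c x))
    intro i hi
    simp only [Finset.mem_image, Finset.mem_filter] at hi ⊢
    obtain ⟨w, ⟨h1, h2⟩, h3⟩ := hi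
    have := hpick x i ⟨w, h1, h2, h3⟩
    exact ⟨pick x i, ⟨this.1, this.2.1, by rw [this.2.2]⟩, this.2.2⟩
  have hcnt := aux_count R B Y (by
    intro x _ x' _ y _ y' _ hxx h1 h2 h3 h4
    by_contra hyy
    refine hC4 x x' y y' hxx hyy h1.1 h2.1 h3.1 h4.1 ?_ ?_
    · intro h; apply hyy; rw [h1.2, h3.2, h]
    · intro h; apply hyy; rw [h2.2, h4.2, h]) _ rfl
  set e := ∑ x ∈ B, (Y.filter (fun y => R x y)).card with he
  have he1 : B.card * (k + 1) ≤ e := by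
    rw [he, ← smul_eq_mul]
    exact Finset.card_nsmul_le_sum _ _ _ hdeg
  have hYne : Y.Nonempty := by
    rcases hne with ⟨x, hx⟩ | h
    · have := (hdeg x hx)
      have : 0 < (Y.filter (fun y => R x y)).card := by omega
      obtain ⟨y, hy⟩ := Finset.card_pos.1 this
      exact ⟨y, (Finset.mem_filter.1 hy).1⟩
    · exact h
  have hb : k + 1 ≤ B.card := by
    obtain ⟨y, hy⟩ := hYne
    exact le_trans (hY y hy) (Finset.card_filter_le _ _)
  have hm : Y.card ≤ n := by simpa using Finset.card_le_univ Y
  have h5 : (k + 1) ^ 2 ≤ e := by nlinarith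
  have h6 : 2 * Y.card < e := by omega
  have h7 : (B.card * (k + 1)) ^ 2 ≤ e ^ 2 := Nat.pow_le_pow_left he1 2
  have h8 : 2 * Y.card * B.card ^ 2 < B.card ^ 2 * (k + 1) ^ 2 := by
    have hb0 : 0 < B.card := by omega
    have : 0 < B.card ^ 2 := by positivity
    have h9 : 2 * Y.card < (k + 1) ^ 2 := by omega
    nlinarith
  have hcnt' : e ^ 2 ≤ Y.card * (B.card ^ 2 + e) := by
    rw [he]; convert hcnt
  have h10 : 2 * Y.card * e ≤ e * e := Nat.mul_le_mul_right _ h6.le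
  rw [mul_pow] at h7
  nlinarith

open Classical in
theorem aux_minimal {n : ℕ} {C : Type*} (G : SimpleGraph (Fin n)) (c : Fin n → Fin n → C) :
    ∃ H : SimpleGraph (Fin n), H ≤ G ∧ (∀ v, c v '' {u | G.Adj v u} ⊆ c v '' {u | H.Adj v u}) ∧
      ∀ u v, H.Adj u v → (∀ w, H.Adj u w → c u w = c u v → w = v) ∨
        (∀ w, H.Adj v w → c v w = c v u → w = u) := by
  obtain ⟨H, hH⟩ := (Set.toFinite {H : SimpleGraph (Fin n) | H ≤ G ∧
    ∀ v, c v '' {u | G.Adj v u} ⊆ c v '' {u | H.Adj v u}}).exists_minimal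
      ⟨G, le_rfl, fun v => le_rfl⟩
  refine ⟨H, hH.prop.1, hH.prop.2, ?_⟩
  intro u v huv
  by_contra hcon
  push Not at hcon
  obtain ⟨⟨w, hw1, hw2, hw3⟩, ⟨z, hz1, hz2, hz3⟩⟩ := hcon
  have hle : H.deleteEdges {s(u, v)} ≤ H := SimpleGraph.deleteEdges_le _
  have := hH.le_of_le (y := H.deleteEdges {s(u, v)}) ⟨hle.trans hH.prop.1, ?_⟩ hle
  · have := this huv
    simp at this
  · intro a i hi
    obtain ⟨b, hb, rfl⟩ := hH.prop.2 a hi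
    by_cases hab : s(a, b) = s(u, v)
    · rw [Sym2.eq_iff] at hab
      rcases hab with ⟨rfl, rfl⟩ | ⟨rfl, rfl⟩
      · refine ⟨w, ?_, hw2⟩
        simp only [Set.mem_ofPred_eq, SimpleGraph.deleteEdges_adj, Set.mem_singleton_iff, Sym2.eq_iff]
        refine ⟨hw1, ?_⟩
        rintro (h | h)
        · exact hw3 h.2
        · exact huv.ne h.1
      · refine ⟨z, ?_, hz2⟩
        simp only [Set.mem_ofPred_eq, SimpleGraph.deleteEdges_adj, Set.mem_singleton_iff, Sym2.eq_iff]
        refine ⟨hz1, ?_⟩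
        rintro (h | h)
        · exact huv.ne h.1.symm
        · exact hz3 h.2
    · refine ⟨b, ?_, rfl⟩
      simp only [Set.mem_ofPred_eq, SimpleGraph.deleteEdges_adj, Set.mem_singleton_iff]
      exact ⟨hb, hab⟩

theorem aux_inj {V : Type*} (a b d e : V) (h1 : a ≠ b) (h2 : a ≠ d) (h3 : a ≠ e)
    (h4 : b ≠ d) (h5 : b ≠ e) (h6 : d ≠ e) : Function.Injective ![a, b, d, e] := by
  intro i j hij
  fin_cases i <;> fin_cases j <;>
    simp [h1, h2, h3, h4, h5, h6, h1.symm, h2.symm, h3.symm, h4.symm, h5.symm, h6.symm] at hij ⊢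

/-- If every digraph on `n` vertices with minimum out-degree at least `fval` contains a
directed cycle of length at most 4, then every edge-colored graph on `n` vertices with
`δ^c(G) ≥ fval + 2√2·√n + 2` contains a properly colored cycle of length at most 4. -/
theorem stmt_18 (n fval : ℕ) {C : Type*}
    (hf : ∀ D : Fin n → Fin n → Prop, (∀ v, ¬ D v v) →
      (∀ v : Fin n, fval ≤ {u | D v u}.ncard) →
      ∃ m : ℕ, 2 ≤ m ∧ m ≤ 4 ∧ ∃ g : ZMod m → Fin n,
        Function.Injective g ∧ ∀ i, D (g i) (g (i + 1)))
    (G : SimpleGraph (Fin n)) (c : Fin n → Fin n → C) (hc : ∀ u v, c u v = c v u)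
    (hδ : ∀ v : Fin n, (fval : ℝ) + 2 * Real.sqrt 2 * Real.sqrt n + 2 ≤
      (((c v) '' {u | G.Adj v u}).ncard : ℝ)) :
    ∃ m : ℕ, 3 ≤ m ∧ m ≤ 4 ∧ ∃ g : ZMod m → Fin n,
      Function.Injective g ∧ (∀ i, G.Adj (g i) (g (i + 1))) ∧
      (∀ i, c (g i) (g (i + 1)) ≠ c (g (i + 1)) (g (i + 2))) := by
  classical
  by_contra hno
  obtain ⟨H, hHG, hHc, hHm⟩ := aux_minimal G c
  let P : Fin n → Fin n → Prop := fun u v => ∀ w, H.Adj u w → c u w = c u v → w = v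
  let L : Fin n → Fin n → Prop := fun y x => H.Adj y x ∧ P y x ∧ (¬ P x y ∨ x < y)
  have hLadj : ∀ y x, L y x → H.Adj y x := fun y x h => h.1
  have hLasym : ∀ y x, L y x → ¬ L x y := by
    rintro y x ⟨_, h1, h2⟩ ⟨_, h3, h4⟩
    rcases h2 with h2 | h2
    · exact h2 h3
    · rcases h4 with h4 | h4
      · exact h4 h1
      · exact absurd h2 (not_lt.2 h4.le)
  have hLtot : ∀ y x, H.Adj y x → L y x ∨ L x y := by
    intro y x h
    by_cases h1 : P y x
    · by_cases h2 : P x y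
      · rcases lt_or_gt_of_ne h.ne with h3 | h3
        · exact Or.inr ⟨h.symm, h2, Or.inr h3⟩
        · exact Or.inl ⟨h, h1, Or.inr h3⟩
      · exact Or.inl ⟨h, h1, Or.inl h2⟩
    · exact Or.inr ⟨h.symm, (hHm y x h).resolve_left h1, Or.inl h1⟩
  have hC4 : ∀ x x' y y', x ≠ x' → y ≠ y' → L y x → L y x' → L y' x → L y' x' →
      c x y ≠ c x y' → c x' y ≠ c x' y' → False := by
    intro x x' y y' hx hy h1 h2 h3 h4 h5 h6
    apply hno
    have a1 := hHG h1.1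
    have a2 := hHG h2.1
    have a3 := hHG h3.1
    have a4 := hHG h4.1
    have b1 : c y x ≠ c y x' := fun h => hx (h2.2.1 x h1.1 h)
    have b2 : c y' x ≠ c y' x' := fun h => hx (h4.2.1 x h3.1 h)
    refine ⟨4, by norm_num, le_rfl, (![x, y, x', y'] : Fin 4 → Fin n), ?_, ?_, ?_⟩
    · exact aux_inj x y x' y' a1.ne.symm hx a3.ne.symm a2.ne hy a4.ne.symm
    · intro i
      change Fin 4 at i
      fin_cases i
      · exact a1.symm
      · exact a2
      · exact a4.symm
      · exact a3
    · intro i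
      change Fin 4 at i
      fin_cases i
      · change c x y ≠ c y x'
        rw [hc x y]; exact b1
      · change c y x' ≠ c x' y'
        rw [hc y x']; exact h6
      · change c x' y' ≠ c y' x
        rw [hc x' y']; exact b2.symm
      · change c y' x ≠ c x y
        rw [hc y' x]; exact h5.symm
  have hk : 2 * n < (Nat.sqrt (2 * n) + 1) ^ 2 := by
    rw [sq]; exact Nat.sqrt_lt.1 (Nat.lt_succ_self _)
  obtain ⟨Q, hQ1, hQ2⟩ := aux_exQ L c (Nat.sqrt (2 * n))
    (aux_stuck L c _ hk hC4) _ Finset.univ Finset.univ rfl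
  let D : Fin n → Fin n → Prop := fun u v =>
    (L u v ∧ ¬ Q v (c v u)) ∨ (L v u ∧ Q u (c u v))
  have hDasym : ∀ u v, D u v → ¬ D v u := by
    rintro u v (⟨h1, h2⟩ | ⟨h1, h2⟩) (⟨h3, h4⟩ | ⟨h3, h4⟩)
    · exact hLasym _ _ h1 h3
    · exact h2 h4
    · exact h4 h2
    · exact hLasym _ _ h1 h3
  have hDadj : ∀ u v, D u v → H.Adj u v := by
    rintro u v (⟨h1, h2⟩ | ⟨h1, h2⟩)
    · exact h1.1
    · exact h1.1.symm
  have hDcol : ∀ u v w, D u v → D v w → c u v ≠ c v w := by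
    intro u v w huv hvw heq
    have huw : u ≠ w := by
      rintro rfl
      exact hDasym _ _ huv hvw
    have hu := hDadj _ _ huv
    have hw := hDadj _ _ hvw
    have heq' : c v u = c v w := by rw [hc v u]; exact heq
    have n1 : ¬ L v u := fun h => huw (h.2.1 w hw heq'.symm).symm
    have n2 : ¬ L v w := fun h => huw (h.2.1 u hu.symm heq')
    rcases huv with ⟨h1, h2⟩ | ⟨h1, h2⟩
    · rcases hvw with ⟨h3, h4⟩ | ⟨h3, h4⟩
      · exact n2 h3
      · rw [heq'] at h2; exact h2 h4
    · exact n1 h1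
  have hDdeg : ∀ v : Fin n, fval ≤ {u | D v u}.ncard := by
    intro v
    have hsub : c v '' {u | G.Adj v u} ⊆ (c v '' {u | D v u}) ∪
        (((((Finset.univ.filter (fun y => L y v)).image (c v)).filter (fun i => ¬ Q v i) :
          Finset C) : Set C) ∪
        (((Finset.univ.filter (fun x => L v x ∧ Q x (c x v))).image (c v) : Finset C) : Set C)) := by
      intro i hi
      obtain ⟨u, hu, rfl⟩ := hHc v hi
      have hu : H.Adj v u := hu
      by_cases hD : D v u
      · exact Or.inl ⟨u, hD, rfl⟩
      · right
        rcases hLtot v u hu with h | h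
        · right
          have hq : Q u (c u v) := by
            by_contra hq
            exact hD (Or.inl ⟨h, hq⟩)
          simp only [Finset.coe_image, Finset.coe_filter, Finset.mem_univ, true_and]
          exact ⟨u, ⟨h, hq⟩, rfl⟩
        · left
          have hq : ¬ Q v (c v u) := fun hq => hD (Or.inr ⟨h, hq⟩)
          simp only [Finset.mem_coe, Finset.mem_filter, Finset.mem_image, Finset.mem_univ, true_and]
          exact ⟨⟨u, h, rfl⟩, hq⟩
    have h1 := Set.ncard_le_ncard hsub (Set.toFinite _)
    have h2 := Set.ncard_union_le (c v '' {u | D v u})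
        (((((Finset.univ.filter (fun y => L y v)).image (c v)).filter (fun i => ¬ Q v i) :
          Finset C) : Set C) ∪
        (((Finset.univ.filter (fun x => L v x ∧ Q x (c x v))).image (c v) : Finset C) : Set C))
    have h3 := Set.ncard_union_le
        (((((Finset.univ.filter (fun y => L y v)).image (c v)).filter (fun i => ¬ Q v i) :
          Finset C) : Set C))
        (((Finset.univ.filter (fun x => L v x ∧ Q x (c x v))).image (c v) : Finset C) : Set C)
    rw [Set.ncard_coe_finset, Set.ncard_coe_finset] at h3
    have h4 : (((Finset.univ.filter (fun y => L y v)).image (c v)).filter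
        (fun i => ¬ Q v i)).card ≤ Nat.sqrt (2 * n) := by
      convert hQ1 v (Finset.mem_univ v)
    have h5 := (Finset.card_image_le (s := Finset.univ.filter (fun x => L v x ∧ Q x (c x v)))
      (f := c v)).trans (show _ ≤ Nat.sqrt (2 * n) by convert hQ2 v (Finset.mem_univ v))
    have h6 : (c v '' {u | D v u}).ncard ≤ {u | D v u}.ncard := Set.ncard_image_le (Set.toFinite _)
    have h7 : (c v '' {u | G.Adj v u}).ncard ≤ {u | D v u}.ncard + 2 * Nat.sqrt (2 * n) := by
      omega
    have h8 : ((Nat.sqrt (2 * n) : ℕ) : ℝ) ≤ Real.sqrt 2 * Real.sqrt n := by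
      rw [← Real.sqrt_mul (by norm_num)]
      have := Real.nat_sqrt_le_real_sqrt (a := 2 * n)
      push_cast at this
      exact this
    have h9 := hδ v
    have h10 : ((c v '' {u | G.Adj v u}).ncard : ℝ) ≤
        ({u | D v u}.ncard : ℝ) + 2 * (Nat.sqrt (2 * n) : ℕ) := by exact_mod_cast h7
    have h11 : (fval : ℝ) ≤ ({u | D v u}.ncard : ℝ) := by nlinarith
    exact_mod_cast h11
  obtain ⟨m, hm2, hm4, g, hg, hgD⟩ := hf D (fun v h => hDasym v v h h) hDdeg
  rcases Nat.lt_or_ge m 3 with hm | hm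
  · have : m = 2 := by omega
    subst this
    have e1 := hgD 0
    have e2 := hgD 1
    have : (1 + 1 : ZMod 2) = 0 := by decide
    rw [this] at e2
    rw [zero_add] at e1
    exact hDasym _ _ e1 e2
  · refine hno ⟨m, hm, hm4, g, hg, fun i => hHG (hDadj _ _ (hgD i)), fun i => ?_⟩
    have e2 := hgD (i + 1)
    have : i + 1 + 1 = i + 2 := by ring
    rw [this] at e2
    exact hDcol _ _ _ (hgD i) e2
end
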